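/- Let (ρ_k) be the iterates of the algorithm ρ₁ = I/D and ρ_{k+1} = exp(log ρ_k + log R(ρ_k)) / tr(exp(log ρ_k + log R(ρ_k))). Then for every k, log ρ_{k+1} ⪰ log ρ_k + log R(ρ_k) in the Loewner order, i.e., log ρ_{k+1} − log ρ_k − log R(ρ_k) is positive semi-definite. -/

import Mathlib

open Matrix
open scoped ComplexOrder

/-- `matFun g A`: apply a real function `g` to a Hermitian matrix `A` via its spectral
decomposition (junk value `0` if `A` is not Hermitian). -/
noncomputable def matFun {D : ℕ} (g : ℝ → ℝ) (A : Matrix (Fin D) (Fin D) ℂ) :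
    Matrix (Fin D) (Fin D) ℂ :=
  if hA : A.IsHermitian then
    (hA.eigenvectorUnitary : Matrix (Fin D) (Fin D) ℂ) *
      Matrix.diagonal (fun i => (g (hA.eigenvalues i) : ℂ)) *
      star (hA.eigenvectorUnitary : Matrix (Fin D) (Fin D) ℂ)
  else 0

/-- Matrix logarithm of a Hermitian (positive definite) matrix. -/
noncomputable def mlog {D : ℕ} (A : Matrix (Fin D) (Fin D) ℂ) : Matrix (Fin D) (Fin D) ℂ :=
  matFun Real.log A

/-- Matrix exponential of a Hermitian matrix. -/
noncomputable def mexp {D : ℕ} (A : Matrix (Fin D) (Fin D) ℂ) : Matrix (Fin D) (Fin D) ℂ :=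
  matFun Real.exp A

/-- `R(ρ) = (1/N) ∑ₙ Mₙ / tr(Mₙ ρ)`. -/
noncomputable def Rmat {D N : ℕ} (M : Fin N → Matrix (Fin D) (Fin D) ℂ)
    (ρ : Matrix (Fin D) (Fin D) ℂ) : Matrix (Fin D) (Fin D) ℂ :=
  (N : ℝ)⁻¹ • ∑ n, (((M n * ρ).trace.re)⁻¹ • M n)

/-- `f(ρ) = (1/N) ∑ₙ −log tr(Mₙ ρ)`. -/
noncomputable def fobj {D N : ℕ} (M : Fin N → Matrix (Fin D) (Fin D) ℂ)
    (ρ : Matrix (Fin D) (Fin D) ℂ) : ℝ :=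
  (N : ℝ)⁻¹ * ∑ n, (- Real.log ((M n * ρ).trace.re))


section GT
open Filter Topology
open scoped MatrixOrder Matrix.Norms.L2Operator

variable {D : ℕ}

lemma trace_conj_re (Z : Matrix (Fin D) (Fin D) ℂ) : (Zᴴ).trace.re = Z.trace.re := by
  rw [Matrix.trace_conjTranspose]; simp

/-- AM-GM form of Cauchy–Schwarz. -/
lemma cs_aux (P Q : Matrix (Fin D) (Fin D) ℂ) :
    2 * (P * Q).trace.re ≤ (P * Pᴴ).trace.re + (Q * Qᴴ).trace.re := by
  have h : 0 ≤ ((P - Qᴴ) * (P - Qᴴ)ᴴ).trace :=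
    (Matrix.posSemidef_self_mul_conjTranspose _).trace_nonneg
  have h' := (Complex.le_def.1 h).1
  simp only [Complex.zero_re, Matrix.conjTranspose_sub, Matrix.conjTranspose_conjTranspose,
    mul_sub, sub_mul, Matrix.trace_sub, Complex.sub_re] at h'
  have h1 : (Qᴴ * Pᴴ).trace.re = (P * Q).trace.re := by
    rw [← Matrix.conjTranspose_mul, trace_conj_re]
  have h2 : (Qᴴ * Q).trace = (Q * Qᴴ).trace := Matrix.trace_mul_comm _ _
  rw [h1, h2] at h'
  linarith

lemma trace_pow_cycle (A B : Matrix (Fin D) (Fin D) ℂ) (m : ℕ) :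
    ((A * B) ^ m).trace = ((B * A) ^ m).trace := by
  cases m with
  | zero => simp
  | succ m =>
    have : ∀ m, (A * B) ^ m * A = A * (B * A) ^ m := by
      intro m
      induction m with
      | zero => simp
      | succ m ih =>
        rw [pow_succ', pow_succ', mul_assoc, ih]; simp only [mul_assoc]
    rw [pow_succ, ← mul_assoc, this, mul_assoc, Matrix.trace_mul_comm, pow_succ, mul_assoc]

lemma FG (k : ℕ) :
    (∀ Z : Matrix (Fin D) (Fin D) ℂ,
      (Z ^ (2 ^ (k + 1))).trace.re ≤ ((Z * Zᴴ) ^ (2 ^ k)).trace.re) ∧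
    (∀ X Y : Matrix (Fin D) (Fin D) ℂ, X.IsHermitian → Y.IsHermitian →
      ((X * Y) ^ (2 ^ k)).trace.re ≤ (X ^ (2 ^ k) * Y ^ (2 ^ k)).trace.re) := by
  induction k with
  | zero =>
    refine ⟨fun Z => ?_, fun X Y _ _ => by simp⟩
    have := cs_aux Z Z
    simp only [zero_add, pow_one, pow_zero, pow_two]
    linarith
  | succ k ih =>
    obtain ⟨F, G⟩ := ih
    refine ⟨fun Z => ?_, fun X Y hX hY => ?_⟩
    · have hP : (Zᴴ * Z).IsHermitian := Matrix.isHermitian_conjTranspose_mul_self Z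
      have hQ : (Z * Zᴴ).IsHermitian := Matrix.isHermitian_mul_conjTranspose_self Z
      have e1 : Z ^ (2 ^ (k + 1 + 1)) = (Z ^ 2) ^ (2 ^ (k + 1)) := by
        rw [← pow_mul, pow_succ' 2 (k + 1)]
      have e2 : ((Z ^ 2 * (Z ^ 2)ᴴ) ^ (2 ^ k)).trace
          = (((Zᴴ * Z) * (Z * Zᴴ)) ^ (2 ^ k)).trace := by
        rw [Matrix.conjTranspose_pow, pow_two, pow_two,
          show Z * Z * (Zᴴ * Zᴴ) = (Z * (Z * Zᴴ)) * Zᴴ by simp only [mul_assoc],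
          trace_pow_cycle]
        simp only [mul_assoc]
      have e3 := cs_aux ((Zᴴ * Z) ^ (2 ^ k)) ((Z * Zᴴ) ^ (2 ^ k))
      rw [(hP.pow _).eq, (hQ.pow _).eq, ← pow_add, ← pow_add, ← two_mul, ← pow_succ',
        trace_pow_cycle Zᴴ Z] at e3
      have f := F (Z ^ 2)
      have g := G _ _ hP hQ
      rw [e1]
      rw [e2] at f
      linarith
    · have f := F (X * Y)
      have g := G (X ^ 2) (Y ^ 2) (hX.pow _) (hY.pow _)
      rw [← pow_mul, ← pow_mul, ← pow_succ'] at g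
      have e : ((X * Y * (X * Y)ᴴ) ^ (2 ^ k)).trace = ((X ^ 2 * Y ^ 2) ^ (2 ^ k)).trace := by
        rw [Matrix.conjTranspose_mul, hX.eq, hY.eq,
          show X * Y * (Y * X) = (X * Y ^ 2) * X by simp only [mul_assoc, pow_two],
          trace_pow_cycle]
        simp only [mul_assoc, pow_two]
      rw [e] at f
      linarith

lemma telescope (X Y : Matrix (Fin D) (Fin D) ℂ) (c : ℝ) (hc : 1 ≤ c) (hX : ‖X‖ ≤ c)
    (hY : ‖Y‖ ≤ c) (h1 : ‖(1 : Matrix (Fin D) (Fin D) ℂ)‖ ≤ 1) (n : ℕ) :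
    ‖X ^ n - Y ^ n‖ ≤ n * c ^ n * ‖X - Y‖ := by
  have hXp : ∀ n, ‖X ^ n‖ ≤ c ^ n := by
    intro n
    induction n with
    | zero => simpa using h1
    | succ n ih =>
      rw [pow_succ, pow_succ]
      exact (norm_mul_le _ _).trans (mul_le_mul ih hX (norm_nonneg _) (by positivity))
  induction n with
  | zero => simp
  | succ n ih =>
    have : X ^ (n + 1) - Y ^ (n + 1) = X ^ n * (X - Y) + (X ^ n - Y ^ n) * Y := by
      rw [pow_succ, pow_succ]; noncomm_ring
    rw [this]
    have a1 : ‖X ^ n * (X - Y)‖ ≤ c ^ n * ‖X - Y‖ :=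
      (norm_mul_le _ _).trans (mul_le_mul_of_nonneg_right (hXp n) (norm_nonneg _))
    have a2 : ‖(X ^ n - Y ^ n) * Y‖ ≤ n * c ^ n * ‖X - Y‖ * c :=
      (norm_mul_le _ _).trans (mul_le_mul ih hY (norm_nonneg _) (by positivity))
    have a3 : c ^ n * ‖X - Y‖ ≤ c ^ n * ‖X - Y‖ * c :=
      le_mul_of_one_le_right (by positivity) hc
    refine (norm_add_le _ _).trans ?_
    push_cast
    rw [pow_succ]
    nlinarith

lemma trotter_aux (f g : ℝ → Matrix (Fin D) (Fin D) ℂ) (a : Matrix (Fin D) (Fin D) ℂ)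
    (h1 : ‖(1 : Matrix (Fin D) (Fin D) ℂ)‖ ≤ 1)
    (hf : HasDerivAt f a 0) (hg : HasDerivAt g a 0) (hf0 : f 0 = 1) (hg0 : g 0 = 1) :
    Tendsto (fun n : ℕ => f ((n : ℝ)⁻¹) ^ n - g ((n : ℝ)⁻¹) ^ n) atTop (𝓝 0) := by
  have key : ∀ f : ℝ → Matrix (Fin D) (Fin D) ℂ, HasDerivAt f a 0 → f 0 = 1 →
      ∃ K : ℝ, 0 ≤ K ∧ ∀ᶠ t in 𝓝 (0 : ℝ), ‖f t‖ ≤ 1 + K * |t| := by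
    intro f hf hf0
    obtain ⟨K, hK⟩ := hf.isBigO_sub.bound
    refine ⟨max K 0, le_max_right _ _, ?_⟩
    filter_upwards [hK] with t ht
    rw [hf0, sub_zero, Real.norm_eq_abs] at ht
    have h2 : ‖f t‖ ≤ ‖f t - 1‖ + ‖(1 : Matrix (Fin D) (Fin D) ℂ)‖ := by
      simpa using norm_add_le (f t - 1) 1
    have h3 : K * |t| ≤ max K 0 * |t| :=
      mul_le_mul_of_nonneg_right (le_max_left _ _) (abs_nonneg _)
    linarith
  obtain ⟨K, hK, hfK⟩ := key f hf hf0
  obtain ⟨L, hL, hgL⟩ := key g hg hg0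
  have ht : Tendsto (fun n : ℕ => (n : ℝ)⁻¹) atTop (𝓝 0) := tendsto_inv_atTop_nhds_zero_nat
  have ho : (fun t => f t - g t) =o[𝓝 (0 : ℝ)] fun t => t := by
    have := (hf.sub hg).isLittleO
    simpa [hf0, hg0] using this
  have hlim := ((ho.comp_tendsto ht).norm_left.tendsto_div_nhds_zero).const_mul (Real.exp (K + L))
  rw [mul_zero] at hlim
  refine squeeze_zero_norm' ?_ hlim
  filter_upwards [ht.eventually hfK, ht.eventually hgL, eventually_gt_atTop 0] with n h2 h3 hn
  have hn' : (0 : ℝ) < n := by exact_mod_cast hn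
  have hinv : (0 : ℝ) < (n : ℝ)⁻¹ := inv_pos.2 hn'
  rw [abs_of_pos hinv] at h2 h3
  have t := telescope (f (n : ℝ)⁻¹) (g (n : ℝ)⁻¹) (1 + (K + L) * (n : ℝ)⁻¹)
    (by have : 0 ≤ (K + L) * (n : ℝ)⁻¹ := by positivity
        linarith) (by nlinarith [mul_nonneg hL hinv.le]) (by nlinarith [mul_nonneg hK hinv.le]) h1 n
  have hc : (1 + (K + L) * (n : ℝ)⁻¹) ^ n ≤ Real.exp (K + L) := by
    have : 1 + (K + L) * (n : ℝ)⁻¹ ≤ Real.exp ((K + L) * (n : ℝ)⁻¹) := by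
      have := Real.add_one_le_exp ((K + L) * (n : ℝ)⁻¹)
      linarith
    calc _ ≤ Real.exp ((K + L) * (n : ℝ)⁻¹) ^ n := pow_le_pow_left₀ (by positivity) this n
      _ = Real.exp (K + L) := by
        rw [← Real.exp_nat_mul]; congr 1; field_simp
  refine t.trans ?_
  simp only [Function.comp_apply]
  rw [div_inv_eq_mul]
  calc (n : ℝ) * (1 + (K + L) * (n : ℝ)⁻¹) ^ n * ‖f (n : ℝ)⁻¹ - g (n : ℝ)⁻¹‖
      ≤ n * Real.exp (K + L) * ‖f (n : ℝ)⁻¹ - g (n : ℝ)⁻¹‖ := by gcongr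
    _ = _ := by ring

open NormedSpace in
lemma trotter (A B : Matrix (Fin D) (Fin D) ℂ)
    (h1 : ‖(1 : Matrix (Fin D) (Fin D) ℂ)‖ ≤ 1) :
    Tendsto (fun n : ℕ => (exp ((n : ℝ)⁻¹ • A) * exp ((n : ℝ)⁻¹ • B)) ^ n) atTop
      (𝓝 (exp (A + B))) := by
  have d : ∀ C : Matrix (Fin D) (Fin D) ℂ, HasDerivAt (fun t : ℝ => exp (t • C)) C 0 := by
    intro C
    simpa using hasDerivAt_exp_smul_const (𝕂 := ℝ) C 0
  have h := trotter_aux (fun t : ℝ => exp (t • A) * exp (t • B)) (fun t : ℝ => exp (t • (A + B)))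
    (A + B) h1 (by
      have := (d A).mul (d B)
      simp only [zero_smul, exp_zero, one_mul, mul_one] at this
      exact this) (d _) (by simp) (by simp)
  have h2 := h.add_const (exp (A + B))
  rw [zero_add] at h2
  refine h2.congr' ?_
  filter_upwards [eventually_gt_atTop 0] with n hn
  have hn' : (n : ℝ) ≠ 0 := by positivity
  have : exp ((n : ℝ)⁻¹ • (A + B)) ^ n = exp (A + B) := by
    rw [← Matrix.exp_nsmul, ← Nat.cast_smul_eq_nsmul ℝ, smul_smul, mul_inv_cancel₀ hn', one_smul]
  simp only [this]
  abel

open NormedSpace in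
/-- Golden–Thompson. -/
lemma golden_thompson (A B : Matrix (Fin D) (Fin D) ℂ) (hA : A.IsHermitian) (hB : B.IsHermitian)
    (h1 : ‖(1 : Matrix (Fin D) (Fin D) ℂ)‖ ≤ 1) :
    (exp (A + B)).trace.re ≤ (exp A * exp B).trace.re := by
  have h := (trotter A B h1).comp (tendsto_pow_atTop_atTop_of_one_lt (one_lt_two : 1 < 2))
  have hc : Continuous fun X : Matrix (Fin D) (Fin D) ℂ => X.trace.re :=
    Complex.continuous_re.comp (continuous_id.matrix_trace)
  have h' := (hc.tendsto _).comp h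
  refine le_of_tendsto' h' fun k => ?_
  simp only [Function.comp_apply]
  have hH : ∀ C : Matrix (Fin D) (Fin D) ℂ, C.IsHermitian → ∀ r : ℝ,
      (exp (r • C)).IsHermitian := by
    intro C hC r
    apply Matrix.IsHermitian.exp
    unfold Matrix.IsHermitian
    rw [Matrix.conjTranspose_smul, hC.eq]; simp
  have hp : ∀ C : Matrix (Fin D) (Fin D) ℂ,
      exp ((((2 ^ k : ℕ)) : ℝ)⁻¹ • C) ^ (2 ^ k) = exp C := by
    intro C
    have hn' : (((2 ^ k : ℕ)) : ℝ) ≠ 0 := by positivity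
    rw [← Matrix.exp_nsmul, ← Nat.cast_smul_eq_nsmul ℝ, smul_smul, mul_inv_cancel₀ hn', one_smul]
  have := (FG k).2 _ _ (hH A hA (((2 ^ k : ℕ)) : ℝ)⁻¹) (hH B hB (((2 ^ k : ℕ)) : ℝ)⁻¹)
  rw [hp, hp] at this
  exact this

lemma matFun_eq_cfc (g : ℝ → ℝ) (A : Matrix (Fin D) (Fin D) ℂ) (hA : A.IsHermitian) :
    matFun g A = cfc g A := by
  rw [hA.cfc_eq, Matrix.IsHermitian.cfc, matFun, dif_pos hA]
  rfl

lemma mlog_eq (A : Matrix (Fin D) (Fin D) ℂ) (hA : A.IsHermitian) : mlog A = CFC.log A :=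
  matFun_eq_cfc _ A hA

lemma mexp_eq (A : Matrix (Fin D) (Fin D) ℂ) (hA : A.IsHermitian) :
    mexp A = NormedSpace.exp A := by
  rw [mexp, matFun_eq_cfc _ A hA]
  exact CFC.real_exp_eq_normedSpace_exp hA

lemma mlog_herm (A : Matrix (Fin D) (Fin D) ℂ) (hA : A.IsHermitian) : (mlog A).IsHermitian := by
  rw [mlog_eq A hA]
  exact IsSelfAdjoint.log

lemma exp_mlog (A : Matrix (Fin D) (Fin D) ℂ) (hA : A.PosDef) :
    NormedSpace.exp (mlog A) = A := by
  rw [mlog_eq A hA.1]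
  exact CFC.exp_log A (Matrix.isStrictlyPositive_iff_posDef.2 hA)

lemma exp_posDef (A : Matrix (Fin D) (Fin D) ℂ) (hA : A.IsHermitian) :
    (NormedSpace.exp A).PosDef := by
  have h : (NormedSpace.exp A).PosSemidef :=
    Matrix.nonneg_iff_posSemidef.1 (IsSelfAdjoint.exp_nonneg hA)
  exact h.posDef_iff_isUnit.2 (Matrix.isUnit_exp A)

lemma mlog_smul_exp (H : Matrix (Fin D) (Fin D) ℂ) (hH : H.IsHermitian) (r : ℝ) (hr : 0 < r) :
    mlog (r • NormedSpace.exp H) = Real.log r • (1 : Matrix (Fin D) (Fin D) ℂ) + H := by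
  have hp := exp_posDef H hH
  rw [mlog_eq _ (hp.1.smul (IsSelfAdjoint.all r)), CFC.log_smul' _ hr
    (Matrix.isStrictlyPositive_iff_posDef.2 hp), CFC.log_exp H hH, Algebra.algebraMap_eq_smul_one]

lemma trace_mul_pos (P ρ : Matrix (Fin D) (Fin D) ℂ) (hP : P.PosSemidef) (hP0 : P ≠ 0)
    (hρ : ρ.PosDef) : 0 < (P * ρ).trace.re := by
  obtain ⟨B, rfl⟩ : ∃ B, P = Bᴴ * B := CStarAlgebra.nonneg_iff_eq_star_mul_self.1 (Matrix.nonneg_iff_posSemidef.2 hP)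
  have hps : (B * ρ * Bᴴ).PosSemidef := hρ.posSemidef.mul_mul_conjTranspose_same B
  have e : (Bᴴ * B * ρ).trace = (B * ρ * Bᴴ).trace := by
    rw [mul_assoc, Matrix.trace_mul_comm]
  rw [e]
  have hne : (B * ρ * Bᴴ).trace ≠ 0 := by
    intro h0
    rw [hps.trace_eq_zero_iff] at h0
    obtain ⟨C, hC⟩ : ∃ C, ρ = Cᴴ * C :=
      CStarAlgebra.nonneg_iff_eq_star_mul_self.1 (Matrix.nonneg_iff_posSemidef.2 hρ.posSemidef)
    have h2 : B * Cᴴ * (B * Cᴴ)ᴴ = 0 := by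
      rw [← h0, hC]; simp [mul_assoc]
    rw [Matrix.self_mul_conjTranspose_eq_zero] at h2
    have h3 : B * ρ = 0 := by rw [hC, ← mul_assoc, h2, zero_mul]
    have h4 : B = 0 := (hρ.isUnit.mul_left_eq_zero).1 h3
    exact hP0 (by simp [h4])
  exact (Complex.lt_def.1 (lt_of_le_of_ne hps.trace_nonneg hne.symm)).1

lemma Rmat_posDef {N : ℕ} (hN : 0 < N)
    (M : Fin N → Matrix (Fin D) (Fin D) ℂ)
    (hM : ∀ n, (M n).PosSemidef) (hMne : ∀ n, M n ≠ 0)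
    (hker : ∀ v : Fin D → ℂ, (∀ n, (M n) *ᵥ v = 0) → v = 0)
    (ρ : Matrix (Fin D) (Fin D) ℂ) (hρ : ρ.PosDef) : (Rmat M ρ).PosDef := by
  have hpos : ∀ n, 0 < ((M n * ρ).trace.re)⁻¹ := fun n =>
    inv_pos.2 (trace_mul_pos _ _ (hM n) (hMne n) hρ)
  have hs : ∀ n, (((M n * ρ).trace.re)⁻¹ • M n).PosSemidef := fun n => (hM n).smul (hpos n).le
  have hS : (∑ n, (((M n * ρ).trace.re)⁻¹ • M n)).PosSemidef :=
    Matrix.posSemidef_sum _ fun n _ => hs n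
  unfold Rmat
  refine Matrix.PosDef.smul ?_ (by positivity : (0:ℝ) < (N : ℝ)⁻¹)
  rw [Matrix.posDef_iff_dotProduct_mulVec]
  refine ⟨hS.1, fun {v} hv => ?_⟩
  refine lt_of_le_of_ne (hS.dotProduct_mulVec_nonneg v) fun h0 => hv (hker v fun n => ?_)
  rw [Matrix.sum_mulVec, dotProduct_sum] at h0
  have := (Finset.sum_eq_zero_iff_of_nonneg
    (fun n _ => (hs n).dotProduct_mulVec_nonneg v)).1 h0.symm n (Finset.mem_univ n)
  rw [(hs n).dotProduct_mulVec_zero_iff, Matrix.smul_mulVec] at this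
  exact (smul_eq_zero.1 this).resolve_left (hpos n).ne'

lemma trace_Rmat {N : ℕ} (hN : 0 < N)
    (M : Fin N → Matrix (Fin D) (Fin D) ℂ)
    (hM : ∀ n, (M n).PosSemidef) (hMne : ∀ n, M n ≠ 0)
    (ρ : Matrix (Fin D) (Fin D) ℂ) (hρ : ρ.PosDef) : (ρ * Rmat M ρ).trace.re = 1 := by
  have hpos : ∀ n, (M n * ρ).trace.re ≠ 0 := fun n =>
    (trace_mul_pos _ _ (hM n) (hMne n) hρ).ne'
  have hN' : (N : ℝ) ≠ 0 := by positivity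
  rw [Matrix.trace_mul_comm, Rmat, Matrix.smul_mul, Matrix.trace_smul, Finset.sum_mul,
    Matrix.trace_sum, Complex.smul_re, Complex.re_sum]
  simp [Matrix.trace_smul, hpos, hN']

lemma step_main {N : ℕ} (hD : 0 < D) (hN : 0 < N)
    (M : Fin N → Matrix (Fin D) (Fin D) ℂ)
    (hM : ∀ n, (M n).PosSemidef) (hMne : ∀ n, M n ≠ 0)
    (hker : ∀ v : Fin D → ℂ, (∀ n, (M n) *ᵥ v = 0) → v = 0)
    (ρ ρ' : Matrix (Fin D) (Fin D) ℂ) (hρ : ρ.PosDef)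
    (hstep : ρ' = ((mexp (mlog ρ + mlog (Rmat M ρ))).trace)⁻¹ •
        mexp (mlog ρ + mlog (Rmat M ρ))) :
    ρ'.PosDef ∧ (mlog ρ' - mlog ρ - mlog (Rmat M ρ)).PosSemidef := by
  have : Nonempty (Fin D) := ⟨⟨0, hD⟩⟩
  have hR := Rmat_posDef hN M hM hMne hker ρ hρ
  have hA := mlog_herm ρ hρ.1
  have hB := mlog_herm _ hR.1
  have hH := hA.add hB
  have h1 : ‖(1 : Matrix (Fin D) (Fin D) ℂ)‖ ≤ 1 := CStarRing.norm_one.le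
  have gt := golden_thompson _ _ hA hB h1
  rw [exp_mlog _ hρ, exp_mlog _ hR, trace_Rmat hN M hM hMne ρ hρ] at gt
  rw [mexp_eq _ hH] at hstep
  have hE := exp_posDef _ hH
  have ht := Complex.lt_def.1 hE.trace_pos
  set H := mlog ρ + mlog (Rmat M ρ) with hHdef
  set t := (NormedSpace.exp H).trace.re with htdef
  have ht0 : 0 < t := ht.1
  have hte : (NormedSpace.exp H).trace = (t : ℂ) := Complex.ext (by simp [htdef]) (by simpa using ht.2.symm)
  have hρ' : ρ' = t⁻¹ • NormedSpace.exp H := by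
    rw [hstep, hte, ← Complex.ofReal_inv]
    ext i j; simp
  have hti : 0 < t⁻¹ := inv_pos.2 ht0
  refine ⟨hρ' ▸ hE.smul hti, ?_⟩
  rw [hρ', mlog_smul_exp H hH _ hti, sub_sub, ← hHdef, add_sub_cancel_right]
  exact Matrix.PosSemidef.one.smul (Real.log_nonneg ((one_le_inv₀ ht0).2 gt))

end GT

/-- The key inequality `log ρ_{k+1} ⪰ log ρ_k + log R(ρ_k)` along the iterates. -/
theorem stmt8 {D N : ℕ} (hD : 0 < D) (hN : 0 < N)
    (M : Fin N → Matrix (Fin D) (Fin D) ℂ)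
    (hM : ∀ n, (M n).PosSemidef) (hMne : ∀ n, M n ≠ 0)
    (hker : ∀ v : Fin D → ℂ, (∀ n, (M n) *ᵥ v = 0) → v = 0)
    (ρ : ℕ → Matrix (Fin D) (Fin D) ℂ)
    (h0 : ρ 0 = (D : ℂ)⁻¹ • 1)
    (hstep : ∀ k, ρ (k + 1) =
      ((mexp (mlog (ρ k) + mlog (Rmat M (ρ k)))).trace)⁻¹ •
        mexp (mlog (ρ k) + mlog (Rmat M (ρ k)))) :
    ∀ k, (mlog (ρ (k + 1)) - mlog (ρ k) - mlog (Rmat M (ρ k))).PosSemidef := by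
  have hpd : ∀ k, (ρ k).PosDef := by
    intro k
    induction k with
    | zero =>
      rw [h0]
      have hD' : (0 : ℂ) < (D : ℂ)⁻¹ := by
        rw [← Complex.ofReal_natCast, ← Complex.ofReal_inv]
        exact Complex.zero_lt_real.2 (by positivity)
      exact Matrix.PosDef.one.smul hD'
    | succ k ih => exact (step_main hD hN M hM hMne hker _ _ ih (hstep k)).1
  exact fun k => (step_main hD hN M hM hMne hker _ _ (hpd k) (hstep k)).2
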